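/- For any b = (b_1,...,b_n) ∈ ℤ_{>0}^n, the number of facets of X_n(b) is n + 2^n - 1 if b_1 ≥ 2, and n + 2^n - 1 - n if b_1 = 1 (i.e., n + 2^n - n - 1 facets); in particular, the facets correspond bijectively to the sets {i} for i ∈ [n] together with the sets S ∪ {n+1} for S ⊊ [n] (with |S| ≠ 1 excluded when b_1 = 1). -/

import Mathlib

/-- Partial sum `S_i = b_1 + ⋯ + b_i`, where `b j` denotes `b_{j+1}` (0-indexed). -/
def Spart (b : ℕ → ℕ) (i : ℕ) : ℕ := ∑ j ∈ Finset.range i, b j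

/-- A `b`-parking function. -/
def IsBParkingFunction (n : ℕ) (b : ℕ → ℕ) (β : Fin n → ℕ) : Prop :=
  (∀ i, 1 ≤ β i) ∧ ∃ σ : Equiv.Perm (Fin n),
    Monotone (β ∘ σ) ∧ ∀ i : Fin n, β (σ i) ≤ Spart b ((i : ℕ) + 1)

/-- The `b`-parking-function polytope. -/
noncomputable def bpfPolytope (n : ℕ) (b : ℕ → ℕ) : Set (Fin n → ℝ) :=
  convexHull ℝ {x | ∃ β : Fin n → ℕ, IsBParkingFunction n b β ∧ x = fun i => (β i : ℝ)}

open Finset Matrix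

section DotFace

variable {n : ℕ}

/-- The set of maximisers over `X` of the linear functional `x ↦ c ⬝ᵥ x`. -/
def dotFace (X : Set (Fin n → ℝ)) (c : Fin n → ℝ) : Set (Fin n → ℝ) :=
  {x ∈ X | ∀ y ∈ X, c ⬝ᵥ y ≤ c ⬝ᵥ x}

theorem isExposed_dotFace (X : Set (Fin n → ℝ)) (c : Fin n → ℝ) :
    IsExposed ℝ X (dotFace X c) :=
  fun _ => ⟨LinearMap.toContinuousLinearMap (dotProductEquiv ℝ (Fin n) c), rfl⟩

theorem IsExposed.exists_eq_dotFace {X F : Set (Fin n → ℝ)} (h : IsExposed ℝ X F)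
    (hF : F.Nonempty) : ∃ c, F = dotFace X c := by
  obtain ⟨l, rfl⟩ := h hF
  refine ⟨(dotProductEquiv ℝ (Fin n)).symm l.toLinearMap, ?_⟩
  have key : ∀ x, (dotProductEquiv ℝ (Fin n)).symm l.toLinearMap ⬝ᵥ x = l x := fun x =>
    LinearMap.congr_fun ((dotProductEquiv ℝ (Fin n)).apply_symm_apply l.toLinearMap) x
  simp only [dotFace, key]

theorem dotFace_smul (X : Set (Fin n → ℝ)) (c : Fin n → ℝ) {t : ℝ} (ht : 0 < t) :
    dotFace X (t • c) = dotFace X c := by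
  simp [dotFace, smul_dotProduct, mul_le_mul_iff_right₀ ht]

theorem dotProduct_eq_of_mem_dotFace {X : Set (Fin n → ℝ)} {c x y : Fin n → ℝ}
    (hx : x ∈ dotFace X c) (hy : y ∈ dotFace X c) : c ⬝ᵥ x = c ⬝ᵥ y :=
  le_antisymm (hy.2 x hx.1) (hx.2 y hy.1)

theorem vectorSpan_le_ker_dotProduct {F : Set (Fin n → ℝ)} {c : Fin n → ℝ}
    (h : ∀ x ∈ F, ∀ y ∈ F, c ⬝ᵥ x = c ⬝ᵥ y) :
    vectorSpan ℝ F ≤ LinearMap.ker (dotProductEquiv ℝ (Fin n) c) := by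
  rw [vectorSpan_def, Submodule.span_le]
  rintro _ ⟨x, hx, y, hy, rfl⟩
  simp [dotProduct_sub, h x hx y hy]

/-- If every functional constant on `F` is a multiple of `c`, then the direction of `F` contains
the hyperplane orthogonal to `c`. -/
theorem ker_dotProduct_le_vectorSpan {F : Set (Fin n → ℝ)} {c : Fin n → ℝ}
    (h : ∀ d : Fin n → ℝ, (∀ x ∈ F, ∀ y ∈ F, d ⬝ᵥ x = d ⬝ᵥ y) → ∃ t : ℝ, d = t • c) :
    LinearMap.ker (dotProductEquiv ℝ (Fin n) c) ≤ vectorSpan ℝ F := by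
  intro v hv
  by_contra hvF
  obtain ⟨f, hfv, hf⟩ := Submodule.exists_le_ker_of_notMem hvF
  obtain ⟨d, rfl⟩ := (dotProductEquiv ℝ (Fin n)).surjective f
  obtain ⟨t, rfl⟩ := h d fun x hx y hy => by
    have := hf (vsub_mem_vectorSpan ℝ hx hy)
    simpa [dotProduct_sub, sub_eq_zero] using this
  apply hfv
  rw [map_smul, LinearMap.smul_apply, LinearMap.mem_ker.1 hv, smul_zero]

theorem finrank_ker_dotProduct {c : Fin n → ℝ} (hc : c ≠ 0) :
    Module.finrank ℝ (LinearMap.ker (dotProductEquiv ℝ (Fin n) c)) = n - 1 := by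
  have h := Module.Dual.finrank_ker_add_one_of_ne_zero
    (f := dotProductEquiv ℝ (Fin n) c) (by simpa using hc)
  rw [Module.finrank_fin_fun] at h
  omega

/-- A facet of a full-dimensional set determines its outer normal up to positive scaling, even
among the functionals whose face merely contains it. -/
theorem exists_pos_smul_of_dotFace_subset {X : Set (Fin n → ℝ)} {c c' : Fin n → ℝ}
    (hX : ∀ d : Fin n → ℝ, (∀ x ∈ X, ∀ y ∈ X, d ⬝ᵥ x = d ⬝ᵥ y) → d = 0)
    (hc : c ≠ 0) (hc' : c' ≠ 0) (hne : (dotFace X c).Nonempty)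
    (hdim : Module.finrank ℝ (vectorSpan ℝ (dotFace X c)) = n - 1)
    (hsub : dotFace X c ⊆ dotFace X c') : ∃ t : ℝ, 0 < t ∧ c' = t • c := by
  have hW : vectorSpan ℝ (dotFace X c) = LinearMap.ker (dotProductEquiv ℝ (Fin n) c) :=
    Submodule.eq_of_le_of_finrank_eq
      (vectorSpan_le_ker_dotProduct fun x hx y hy => dotProduct_eq_of_mem_dotFace hx hy)
      (by rw [hdim, finrank_ker_dotProduct hc])
  have hker : LinearMap.ker (dotProductEquiv ℝ (Fin n) c) ≤
      LinearMap.ker (dotProductEquiv ℝ (Fin n) c') :=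
    hW ▸ vectorSpan_le_ker_dotProduct fun x hx y hy =>
      dotProduct_eq_of_mem_dotFace (hsub hx) (hsub hy)
  have hmem := mem_span_of_iInf_ker_le_ker (ι := Unit) (L := fun _ => dotProductEquiv ℝ (Fin n) c)
    (K := dotProductEquiv ℝ (Fin n) c') (by simpa using hker)
  rw [Set.range_const, Submodule.mem_span_singleton] at hmem
  obtain ⟨t, ht⟩ := hmem
  rw [← map_smul, EmbeddingLike.apply_eq_iff_eq] at ht
  refine ⟨t, ?_, ht.symm⟩
  by_contra! hle
  obtain ⟨x, hx⟩ := hne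
  refine hc' (hX c' ?_)
  have hconst : ∀ y ∈ X, c' ⬝ᵥ y = c' ⬝ᵥ x := fun y hy => by
    refine le_antisymm ((hsub hx).2 y hy) ?_
    rw [← ht, smul_dotProduct, smul_dotProduct]
    exact mul_le_mul_of_nonpos_left (hx.2 y hy) hle
  intro y hy z hz
  rw [hconst y hy, hconst z hz]

end DotFace

section ParkingFunction

variable {n : ℕ} {b : ℕ → ℕ}

theorem Spart_mono (b : ℕ → ℕ) : Monotone (Spart b) := fun _ _ h =>
  Finset.sum_le_sum_of_subset (Finset.range_mono h)

theorem Spart_lt_Spart (hb : ∀ j < n, 1 ≤ b j) {i j : ℕ} (hij : i < j) (hj : j ≤ n) :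
    Spart b i < Spart b j := by
  have h1 : Spart b (i + 1) = Spart b i + b i := Finset.sum_range_succ _ _
  have h2 := hb i (by omega)
  have h3 := Spart_mono b (show i + 1 ≤ j from hij)
  omega

theorem one_le_Spart_succ (hb : ∀ j < n, 1 ≤ b j) (i : Fin n) : 1 ≤ Spart b (i + 1) :=
  Nat.one_le_iff_ne_zero.2 (Nat.ne_zero_of_lt (Spart_lt_Spart hb (Nat.succ_pos i) i.2))

/-- Any rearrangement satisfying the bounds certifies a parking function: sorting can only help. -/
theorem isBParkingFunction_of_perm {β : Fin n → ℕ} (h1 : ∀ i, 1 ≤ β i) (τ : Equiv.Perm (Fin n))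
    (hτ : ∀ i, β i ≤ Spart b (τ.symm i + 1)) : IsBParkingFunction n b β := by
  refine ⟨h1, Tuple.sort β, Tuple.monotone_sort β, fun i => ?_⟩
  by_contra! hi
  have hmaps : ∀ j ∈ Finset.Iic i, (Tuple.sort β).symm (τ j) ∈ Finset.Iio i := by
    intro j hj
    rw [Finset.mem_Iic] at hj
    rw [Finset.mem_Iio]
    by_contra! hle
    have h2 := Tuple.monotone_sort β hle
    have h3 := hτ (τ j)
    have h4 := Spart_mono b (Nat.succ_le_succ (Fin.le_def.1 hj))
    simp only [Function.comp_apply, Equiv.apply_symm_apply] at h2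
    simp only [Equiv.symm_apply_apply] at h3
    simp only [Nat.succ_eq_add_one] at h4
    omega
  have := Finset.card_le_card_of_injOn (fun j => (Tuple.sort β).symm (τ j)) hmaps
    (fun x _ y _ hxy => by simpa using hxy)
  simp at this

theorem natCast_mem_bpfPolytope {β : Fin n → ℕ} (h1 : ∀ i, 1 ≤ β i) (τ : Equiv.Perm (Fin n))
    (hτ : ∀ i, β i ≤ Spart b (τ.symm i + 1)) : (fun i => (β i : ℝ)) ∈ bpfPolytope n b :=
  subset_convexHull ℝ _ ⟨β, isBParkingFunction_of_perm h1 τ hτ, rfl⟩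

theorem dotProduct_le_of_mem_bpfPolytope {c : Fin n → ℝ} {M : ℝ}
    (h : ∀ β : Fin n → ℕ, IsBParkingFunction n b β → c ⬝ᵥ (fun i => (β i : ℝ)) ≤ M)
    {x : Fin n → ℝ} (hx : x ∈ bpfPolytope n b) : c ⬝ᵥ x ≤ M := by
  refine convexHull_min (t := {x | c ⬝ᵥ x ≤ M}) ?_
    (convex_halfSpace_le (dotProductEquiv ℝ (Fin n) c).isLinear M) hx
  rintro _ ⟨β, hβ, rfl⟩
  exact h β hβ

theorem one_le_of_mem_bpfPolytope {x : Fin n → ℝ} (hx : x ∈ bpfPolytope n b) (i : Fin n) :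
    1 ≤ x i := by
  have := dotProduct_le_of_mem_bpfPolytope (c := -Pi.single i 1) (M := -1)
    (fun β hβ => by simpa using hβ.1 i) hx
  simpa using this

theorem update_one_mem_bpfPolytope {x : Fin n → ℝ} (hx : x ∈ bpfPolytope n b) (i : Fin n) :
    Function.update x i 1 ∈ bpfPolytope n b := by
  refine convexHull_min (t := {x | Function.update x i 1 ∈ bpfPolytope n b}) ?_ ?_ hx
  · rintro _ ⟨β, ⟨h1, σ, -, hσ⟩, rfl⟩
    have := natCast_mem_bpfPolytope (b := b) (β := Function.update β i 1) (fun j => by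
      rcases eq_or_ne j i with rfl | hj <;> simp [*]) σ (fun j => by
      have h2 := hσ (σ.symm j)
      rw [Equiv.apply_symm_apply] at h2
      rcases eq_or_ne j i with rfl | hj
      · simpa using (h1 j).trans h2
      · simpa [hj] using h2)
    change Function.update _ i 1 ∈ bpfPolytope n b
    convert this using 1
    ext j
    rcases eq_or_ne j i with rfl | hj <;> simp [*]
  · intro y hy z hz s t hs ht hst
    have : s • Function.update y i 1 + t • Function.update z i 1 ∈ bpfPolytope n b :=
      convex_convexHull ℝ _ hy hz hs ht hst
    change Function.update _ i 1 ∈ bpfPolytope n b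
    convert this using 1
    ext j
    rcases eq_or_ne j i with rfl | hj <;> simp [*]

/-- The vertex of the polytope whose coordinate in position `τ k` is `S_{k+1}`. -/
def permVertex (b : ℕ → ℕ) (τ : Equiv.Perm (Fin n)) : Fin n → ℝ :=
  fun i => (Spart b (τ.symm i + 1) : ℝ)

theorem permVertex_mem (hb : ∀ j < n, 1 ≤ b j) (τ : Equiv.Perm (Fin n)) :
    permVertex b τ ∈ bpfPolytope n b :=
  natCast_mem_bpfPolytope (β := fun i => Spart b (τ.symm i + 1))
    (fun _ => one_le_Spart_succ hb _) τ fun _ => le_rfl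

/-- A nonnegative functional is maximised at any vertex sorted compatibly with it. -/
theorem dotProduct_le_permVertex {c : Fin n → ℝ} (hc : ∀ i, 0 ≤ c i) {τ : Equiv.Perm (Fin n)}
    (hτ : Monotone (c ∘ τ)) {x : Fin n → ℝ} (hx : x ∈ bpfPolytope n b) :
    c ⬝ᵥ x ≤ c ⬝ᵥ permVertex b τ := by
  refine dotProduct_le_of_mem_bpfPolytope ?_ hx
  rintro β ⟨-, σ, -, hσ⟩
  have hS : Monotone fun i : Fin n => (Spart b (i + 1) : ℝ) := fun i j hij =>
    Nat.cast_le.2 (Spart_mono b (Nat.succ_le_succ hij))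
  calc c ⬝ᵥ (fun i => (β i : ℝ)) = ∑ i, c (σ i) * β (σ i) :=
        (Equiv.sum_comp σ fun i => c i * (β i : ℝ)).symm
    _ ≤ ∑ i, c (σ i) * Spart b (i + 1) := Finset.sum_le_sum fun i _ =>
        mul_le_mul_of_nonneg_left (Nat.cast_le.2 (hσ i)) (hc _)
    _ = ∑ i, (c ∘ τ) ((σ.trans τ.symm) i) * Spart b (i + 1) := by simp
    _ ≤ ∑ i, (c ∘ τ) i * Spart b (i + 1) := (hτ.monovary hS).sum_comp_perm_mul_le_sum_mul
    _ = c ⬝ᵥ permVertex b τ := by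
        rw [dotProduct, ← Equiv.sum_comp τ fun i => c i * permVertex b τ i]
        simp [permVertex]

theorem mem_dotFace_of_dotProduct_eq {c : Fin n → ℝ} (hc : ∀ i, 0 ≤ c i)
    {τ : Equiv.Perm (Fin n)} (hτ : Monotone (c ∘ τ)) {x : Fin n → ℝ} (hx : x ∈ bpfPolytope n b)
    (h : c ⬝ᵥ x = c ⬝ᵥ permVertex b τ) : x ∈ dotFace (bpfPolytope n b) c :=
  ⟨hx, fun _ hy => h ▸ dotProduct_le_permVertex hc hτ hy⟩

theorem permVertex_mem_dotFace (hb : ∀ j < n, 1 ≤ b j) {c : Fin n → ℝ} (hc : ∀ i, 0 ≤ c i)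
    {τ : Equiv.Perm (Fin n)} (hτ : Monotone (c ∘ τ)) :
    permVertex b τ ∈ dotFace (bpfPolytope n b) c :=
  mem_dotFace_of_dotProduct_eq hc hτ (permVertex_mem hb τ) rfl

theorem one_mem_bpfPolytope (hb : ∀ j < n, 1 ≤ b j) : (1 : Fin n → ℝ) ∈ bpfPolytope n b := by
  have := natCast_mem_bpfPolytope (n := n) (b := b) (β := 1) (fun _ => le_rfl) 1
    fun _ => one_le_Spart_succ hb _
  convert this using 1
  ext
  simp

theorem one_add_single_mem_bpfPolytope (hn : 1 ≤ n) (hb : ∀ j < n, 1 ≤ b j) (j : Fin n) :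
    (1 + Pi.single j ((Spart b n : ℝ) - 1) : Fin n → ℝ) ∈ bpfPolytope n b := by
  have hpos : 1 ≤ Spart b n := by
    simpa [Nat.sub_add_cancel hn] using one_le_Spart_succ hb ⟨n - 1, by omega⟩
  have := natCast_mem_bpfPolytope (b := b) (β := Function.update 1 j (Spart b n))
    (fun i => by rcases eq_or_ne i j with rfl | hi <;> simp [*])
    (Equiv.swap j ⟨n - 1, by omega⟩) (fun i => by
      rcases eq_or_ne i j with rfl | hi
      · simp [Nat.sub_add_cancel hn]
      · simpa [hi] using one_le_Spart_succ hb _)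
  convert this using 1
  ext i
  rcases eq_or_ne i j with rfl | hi <;> simp [*]

theorem two_le_Spart (hn : 1 ≤ n) (hb : ∀ j < n, 1 ≤ b j) (hnd : ¬(n = 1 ∧ b 0 = 1)) :
    2 ≤ Spart b n := by
  have h0 := hb 0 hn
  have h1 : Spart b 1 = b 0 := by simp [Spart]
  rcases hn.eq_or_lt with rfl | hn'
  · simp only [true_and] at hnd
    omega
  · have := Spart_lt_Spart hb hn' le_rfl
    omega

theorem apply_eq_zero_of_dotProduct_eq (hn : 1 ≤ n) (hb : ∀ j < n, 1 ≤ b j)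
    (hnd : ¬(n = 1 ∧ b 0 = 1)) {d : Fin n → ℝ} {j : Fin n}
    (h : d ⬝ᵥ (1 + Pi.single j ((Spart b n : ℝ) - 1)) = d ⬝ᵥ 1) : d j = 0 := by
  have h2 : (2 : ℝ) ≤ Spart b n := by exact_mod_cast two_le_Spart hn hb hnd
  rw [dotProduct_add, dotProduct_single, add_eq_left, mul_eq_zero] at h
  exact h.resolve_right (by linarith)

/-- The polytope is full-dimensional. -/
theorem eq_zero_of_dotProduct_const (hn : 1 ≤ n) (hb : ∀ j < n, 1 ≤ b j)
    (hnd : ¬(n = 1 ∧ b 0 = 1)) (d : Fin n → ℝ)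
    (h : ∀ x ∈ bpfPolytope n b, ∀ y ∈ bpfPolytope n b, d ⬝ᵥ x = d ⬝ᵥ y) : d = 0 :=
  funext fun j => apply_eq_zero_of_dotProduct_eq hn hb hnd
    (h _ (one_add_single_mem_bpfPolytope hn hb j) _ (one_mem_bpfPolytope hb))

end ParkingFunction

section FacetNormals

variable {n : ℕ} {b : ℕ → ℕ}

/-- The indicator vector of `I`. -/
def indicatorVec (I : Finset (Fin n)) : Fin n → ℝ := fun i => if i ∈ I then 1 else 0

theorem indicatorVec_nonneg (I : Finset (Fin n)) (i : Fin n) : 0 ≤ indicatorVec I i := by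
  unfold indicatorVec
  split_ifs <;> norm_num

theorem indicatorVec_injective : Function.Injective (indicatorVec (n := n)) := by
  intro I J h
  ext i
  have := congrFun h i
  by_cases hI : i ∈ I <;> by_cases hJ : i ∈ J <;> simp_all [indicatorVec]

/-- The index sets `I` for which `U_I` is a facet. -/
def upperIndexSets (n : ℕ) (b : ℕ → ℕ) : Finset (Finset (Fin n)) :=
  {I | I.Nonempty ∧ (b 0 = 1 → #I ≠ n - 1)}

/-- Outer normals of the facets: `-e_i` for `L_i`, and the indicator vector of `I` for `U_I`. -/
def facetNormals (n : ℕ) (b : ℕ → ℕ) : Set (Fin n → ℝ) :=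
  Set.range (fun i : Fin n => (-Pi.single i 1 : Fin n → ℝ)) ∪
    indicatorVec '' (upperIndexSets n b : Set (Finset (Fin n)))

theorem card_upperIndexSets (hn : 1 ≤ n) (hb : ∀ j < n, 1 ≤ b j) (hnd : ¬(n = 1 ∧ b 0 = 1)) :
    #(upperIndexSets n b) = if 2 ≤ b 0 then 2 ^ n - 1 else 2 ^ n - 1 - n := by
  have h0 := hb 0 hn
  have hne : #(univ.erase (∅ : Finset (Fin n))) = 2 ^ n - 1 := by
    rw [card_erase_of_mem (mem_univ _), card_univ, Fintype.card_finset, Fintype.card_fin]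
  split_ifs with h2
  · rw [← hne]
    congr 1
    ext I
    simp [upperIndexSets, nonempty_iff_ne_empty, show b 0 ≠ 1 by omega]
  · have hb1 : b 0 = 1 := by omega
    have hn2 : 2 ≤ n := by
      simp only [hb1, and_true] at hnd
      omega
    have hcard : #(powersetCard (n - 1) (univ : Finset (Fin n))) = n := by
      rw [card_powersetCard, card_univ, Fintype.card_fin, Nat.choose_symm hn, Nat.choose_one_right]
    have hsub : powersetCard (n - 1) (univ : Finset (Fin n)) ⊆ univ.erase ∅ := by
      intro I hI
      have hI' := (mem_powersetCard.1 hI).2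
      refine mem_erase.2 ⟨?_, mem_univ _⟩
      rintro rfl
      rw [card_empty] at hI'
      omega
    rw [← hne, show #(univ.erase (∅ : Finset (Fin n))) - n =
      #(univ.erase (∅ : Finset (Fin n)) \ powersetCard (n - 1) univ) by
        rw [card_sdiff_of_subset hsub, hcard]]
    congr 1
    ext I
    simp [upperIndexSets, nonempty_iff_ne_empty, hb1, mem_powersetCard]

theorem ncard_facetNormals (hn : 1 ≤ n) (hb : ∀ j < n, 1 ≤ b j) (hnd : ¬(n = 1 ∧ b 0 = 1)) :
    (facetNormals n b).ncard = if 2 ≤ b 0 then n + 2 ^ n - 1 else n + 2 ^ n - 1 - n := by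
  have hinj : Function.Injective fun i : Fin n => (-Pi.single i 1 : Fin n → ℝ) := by
    intro i j h
    by_contra hij
    simpa [hij] using congrFun h i
  have hdisj : Disjoint (Set.range fun i : Fin n => (-Pi.single i 1 : Fin n → ℝ))
      (indicatorVec '' (upperIndexSets n b : Set (Finset (Fin n)))) := by
    rw [Set.disjoint_left]
    rintro _ ⟨i, rfl⟩ ⟨I, -, h⟩
    have h1 := congrFun h i
    have h2 := indicatorVec_nonneg I i
    simp only [Pi.neg_apply, Pi.single_eq_same] at h1
    linarith
  rw [facetNormals, Set.ncard_union_eq hdisj (Set.finite_range _) (Set.toFinite _),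
    Set.ncard_image_of_injective _ indicatorVec_injective, Set.ncard_coe_finset,
    ← Set.image_univ, Set.ncard_image_of_injective _ hinj, Set.ncard_univ, Nat.card_fin,
    card_upperIndexSets hn hb hnd]
  have h2n : n < 2 ^ n := Nat.lt_two_pow_self
  split_ifs <;> omega

theorem ne_zero_of_mem_facetNormals {c : Fin n → ℝ} (hc : c ∈ facetNormals n b) : c ≠ 0 := by
  rcases hc with ⟨i, rfl⟩ | ⟨I, hI, rfl⟩
  · simp
  · obtain ⟨i, hi⟩ := (mem_filter.1 hI).2.1
    intro h
    simpa [indicatorVec, hi] using congrFun h i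

theorem eq_of_mem_facetNormals {c c' : Fin n → ℝ} (hc : c ∈ facetNormals n b)
    (hc' : c' ∈ facetNormals n b) {t : ℝ} (ht : 0 < t) (h : c' = t • c) : c' = c := by
  have happ : ∀ i, c' i = t * c i := fun i => congrFun h i
  rcases hc with ⟨i, rfl⟩ | ⟨I, hI, rfl⟩ <;> rcases hc' with ⟨j, rfl⟩ | ⟨J, hJ, rfl⟩
  · rcases eq_or_ne j i with rfl | hij
    · rfl
    · simpa [hij] using happ j
  · have h1 := happ i
    have h2 := indicatorVec_nonneg J i
    simp only [Pi.neg_apply, Pi.single_eq_same] at h1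
    linarith
  · have h1 := happ j
    have h2 := mul_nonneg ht.le (indicatorVec_nonneg I j)
    simp only [Pi.neg_apply, Pi.single_eq_same] at h1
    linarith
  · congr 1
    ext i
    have h1 := happ i
    by_cases hi : i ∈ I <;> by_cases hj : i ∈ J <;> simp_all [indicatorVec]

theorem mem_dotFace_neg_single {x : Fin n → ℝ} (hx : x ∈ bpfPolytope n b) {i : Fin n}
    (hi : x i = 1) : x ∈ dotFace (bpfPolytope n b) (-Pi.single i 1) :=
  ⟨hx, fun y hy => by simpa [hi] using one_le_of_mem_bpfPolytope hy i⟩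

theorem dotFace_nonempty_of_mem_facetNormals (hb : ∀ j < n, 1 ≤ b j) {c : Fin n → ℝ}
    (hc : c ∈ facetNormals n b) : (dotFace (bpfPolytope n b) c).Nonempty := by
  rcases hc with ⟨i, rfl⟩ | ⟨I, -, rfl⟩
  · exact ⟨1, mem_dotFace_neg_single (one_mem_bpfPolytope hb) rfl⟩
  · exact ⟨_, permVertex_mem_dotFace hb (indicatorVec_nonneg I) (Tuple.monotone_sort _)⟩

theorem dotFace_subset_neg_single {c : Fin n → ℝ} {i : Fin n} (hi : c i < 0) :
    dotFace (bpfPolytope n b) c ⊆ dotFace (bpfPolytope n b) (-Pi.single i 1) := by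
  rintro x ⟨hx, hmax⟩
  refine mem_dotFace_neg_single hx (le_antisymm ?_ (one_le_of_mem_bpfPolytope hx i))
  have h := hmax _ (update_one_mem_bpfPolytope hx i)
  have hupd : Function.update x i 1 = x + Pi.single i (1 - x i) := by
    ext j
    rcases eq_or_ne j i with rfl | hj <;> simp [*]
  rw [hupd, dotProduct_add, dotProduct_single] at h
  nlinarith

/-- The face of a nonnegative functional lies in the face of the indicator of its largest
coefficients. -/
theorem dotFace_subset_indicatorVec (hb : ∀ j < n, 1 ≤ b j) {c : Fin n → ℝ}
    (hc : ∀ i, 0 ≤ c i) (hc0 : c ≠ 0) : ∃ I : Finset (Fin n), I.Nonempty ∧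
      dotFace (bpfPolytope n b) c ⊆ dotFace (bpfPolytope n b) (indicatorVec I) := by
  obtain ⟨k, hk⟩ := Function.ne_iff.1 hc0
  obtain ⟨m, -, hm⟩ := exists_max_image univ c ⟨k, mem_univ k⟩
  have hm' : ∀ i, c i ≤ c m := fun i => hm i (mem_univ i)
  have hpos : 0 < c m := ((hc k).lt_of_ne' hk).trans_le (hm' k)
  obtain ⟨s, hs0, hsm, hs⟩ : ∃ s, 0 ≤ s ∧ s < c m ∧ ∀ i, c i ≠ c m → c i ≤ s := by
    rcases ({i | c i ≠ c m} : Finset (Fin n)).eq_empty_or_nonempty with hJ | hJ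
    · exact ⟨0, le_rfl, hpos, fun i hi => by simp_all [filter_eq_empty_iff]⟩
    · obtain ⟨j, hj, hjmax⟩ := exists_max_image _ c hJ
      exact ⟨c j, hc j, (hm' j).lt_of_ne (mem_filter.1 hj).2,
        fun i hi => hjmax i (mem_filter.2 ⟨mem_univ i, hi⟩)⟩
  set I : Finset (Fin n) := {i | c i = c m} with hI
  refine ⟨I, ⟨m, by simp [hI]⟩, fun x hx => ?_⟩
  set c' : Fin n → ℝ := fun i => min (c i) s
  have hsplit : c = (c m - s) • indicatorVec I + c' := by
    ext i
    by_cases hi : c i = c m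
    · simp [hI, c', indicatorVec, hi, hsm.le]
    · simp [hI, c', indicatorVec, hi, hs i hi]
  have hτ := Tuple.monotone_sort c
  have hτI : Monotone (indicatorVec I ∘ Tuple.sort c) := by
    intro i j hij
    have h1 := hτ hij
    have h2 := hm' (Tuple.sort c j)
    simp only [Function.comp_apply, indicatorVec, hI, mem_filter, mem_univ, true_and] at h1 ⊢
    split_ifs with hi hj
    · rfl
    · exact absurd (le_antisymm h2 (hi ▸ h1)) hj
    · exact zero_le_one
    · rfl
  have hle := dotProduct_le_permVertex (b := b) (c := c') (fun i => le_min (hc i) hs0)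
    (fun i j hij => min_le_min_right s (hτ hij)) hx.1
  have hge := hx.2 _ (permVertex_mem hb (Tuple.sort c))
  rw [hsplit, add_dotProduct, add_dotProduct, smul_dotProduct, smul_dotProduct, ← hsplit] at hge
  refine mem_dotFace_of_dotProduct_eq (indicatorVec_nonneg I) hτI hx.1
    (le_antisymm (dotProduct_le_permVertex (indicatorVec_nonneg I) hτI hx.1) ?_)
  refine le_of_mul_le_mul_left ?_ (sub_pos.2 hsm)
  simp only [smul_eq_mul] at hge
  linarith

/-- If `b_1 = 1` and `|I| = n - 1`, then `U_I` is contained in some `L_j`. -/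
theorem dotFace_indicatorVec_subset_neg_single (hn : 1 ≤ n) (hb : ∀ j < n, 1 ≤ b j)
    (hb1 : b 0 = 1) {I : Finset (Fin n)} (hI : #I = n - 1) : ∃ j : Fin n,
      dotFace (bpfPolytope n b) (indicatorVec I) ⊆
        dotFace (bpfPolytope n b) (-Pi.single j 1) := by
  obtain ⟨j, hj⟩ : ∃ j, Iᶜ = {j} := card_eq_one.1 (by
    rw [card_compl, Fintype.card_fin]
    omega)
  have hmem : ∀ i, i ∉ I ↔ i = j := fun i => by rw [← mem_compl, hj, mem_singleton]
  refine ⟨j, fun x hx => mem_dotFace_neg_single hx.1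
    (le_antisymm ?_ (one_le_of_mem_bpfPolytope hx.1 j))⟩
  set τ := Tuple.sort (indicatorVec I)
  have hτ : Monotone (indicatorVec I ∘ τ) := Tuple.monotone_sort _
  have hτj : τ ⟨0, hn⟩ = j := by
    have h1 := hτ (show (⟨0, hn⟩ : Fin n) ≤ τ.symm j from Nat.zero_le _)
    rw [← hmem]
    intro h2
    simp [indicatorVec, h2, (hmem j).2 rfl] at h1
    linarith
  have hvj : permVertex b τ j = 1 := by
    rw [permVertex, ← hτj, Equiv.symm_apply_apply]
    simp [Spart, hb1]
  have hsum := dotProduct_le_permVertex (b := b) (c := 1) (τ := τ) (fun _ => zero_le_one)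
    (fun _ _ _ => le_rfl) hx.1
  have hone : (1 : Fin n → ℝ) = indicatorVec I + Pi.single j 1 := by
    ext i
    rcases eq_or_ne i j with rfl | hi
    · simp [indicatorVec, (hmem i).2 rfl]
    · simp [indicatorVec, hi, not_not.1 (mt (hmem i).1 hi)]
  have heq := dotProduct_eq_of_mem_dotFace hx
    (permVertex_mem_dotFace hb (indicatorVec_nonneg I) hτ)
  rw [hone, add_dotProduct, add_dotProduct, single_dotProduct, single_dotProduct, hvj, heq] at hsum
  linarith

theorem exists_facetNormal_dotFace_subset (hn : 1 ≤ n) (hb : ∀ j < n, 1 ≤ b j)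
    {c : Fin n → ℝ} (hc0 : c ≠ 0) : ∃ c' ∈ facetNormals n b,
      dotFace (bpfPolytope n b) c ⊆ dotFace (bpfPolytope n b) c' := by
  by_cases hc : ∀ i, 0 ≤ c i
  · obtain ⟨I, hI, hsub⟩ := dotFace_subset_indicatorVec hb hc hc0
    by_cases hex : b 0 = 1 ∧ #I = n - 1
    · obtain ⟨j, hj⟩ := dotFace_indicatorVec_subset_neg_single hn hb hex.1 hex.2
      exact ⟨_, Or.inl ⟨j, rfl⟩, hsub.trans hj⟩
    · exact ⟨_, Or.inr ⟨I, by simpa [upperIndexSets, hI] using hex, rfl⟩, hsub⟩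
  · push Not at hc
    obtain ⟨i, hi⟩ := hc
    exact ⟨_, Or.inl ⟨i, rfl⟩, dotFace_subset_neg_single hi⟩

/-- Transposing two coordinates on which the normal agrees moves a sorted vertex inside its face,
so functionals constant on that face agree on these coordinates too. -/
theorem apply_eq_of_const_on_dotFace (hb : ∀ j < n, 1 ≤ b j) {c d : Fin n → ℝ}
    (hc : ∀ i, 0 ≤ c i) (hd : ∀ x ∈ dotFace (bpfPolytope n b) c,
      ∀ y ∈ dotFace (bpfPolytope n b) c, d ⬝ᵥ x = d ⬝ᵥ y) {i j : Fin n} (hij : c i = c j) :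
    d i = d j := by
  rcases eq_or_ne i j with rfl | hne
  · rfl
  set τ := Tuple.sort c
  have hτ : Monotone (c ∘ τ) := Tuple.monotone_sort _
  have hτ' : Monotone (c ∘ (Equiv.swap i j * τ : Equiv.Perm (Fin n))) := by
    convert hτ using 1
    ext k
    simp only [Function.comp_apply, Equiv.Perm.mul_apply, Equiv.swap_apply_def]
    split_ifs with h1 h2 <;> simp [*]
  have h := hd _ (permVertex_mem_dotFace hb hc hτ') _ (permVertex_mem_dotFace hb hc hτ)
  have hdiff : permVertex b (Equiv.swap i j * τ : Equiv.Perm (Fin n)) = permVertex b τ +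
      (Pi.single i (permVertex b τ j - permVertex b τ i) -
        Pi.single j (permVertex b τ j - permVertex b τ i)) := by
    have hap : ∀ k, permVertex b (Equiv.swap i j * τ : Equiv.Perm (Fin n)) k =
        permVertex b τ (Equiv.swap i j k) := fun k => rfl
    ext k
    rw [hap]
    rcases eq_or_ne k i with rfl | hki
    · simp [hne]
    · rcases eq_or_ne k j with rfl | hkj
      · simp [hki]
      · simp [hki, hkj, Equiv.swap_apply_of_ne_of_ne]
  have hvne : permVertex b τ j - permVertex b τ i ≠ 0 := by
    rw [sub_ne_zero]
    simp only [permVertex, ne_eq, Nat.cast_inj]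
    rcases lt_trichotomy (τ.symm i) (τ.symm j) with hlt | heq | hlt
    · exact (Spart_lt_Spart hb (Nat.succ_lt_succ hlt) (τ.symm j).2).ne'
    · exact absurd (τ.symm.injective heq) hne
    · exact (Spart_lt_Spart hb (Nat.succ_lt_succ hlt) (τ.symm i).2).ne
  rw [hdiff, dotProduct_add, dotProduct_sub, dotProduct_single, dotProduct_single, add_eq_left,
    ← sub_mul, mul_eq_zero] at h
  exact sub_eq_zero.1 (h.resolve_right hvne)

theorem exists_notMem_two_le_Spart (hb : ∀ j < n, 1 ≤ b j) {I : Finset (Fin n)}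
    (hI : I ∈ upperIndexSets n b) (hIu : I ≠ univ) (τ : Equiv.Perm (Fin n)) :
    ∃ k, k ∉ I ∧ 2 ≤ Spart b (τ.symm k + 1) := by
  obtain ⟨j, hj⟩ : ∃ j, j ∉ I := by simpa [eq_univ_iff_forall] using hIu
  have hn : 0 < n := j.pos
  have h0 := hb 0 hn
  have hS1 : Spart b 1 = b 0 := by simp [Spart]
  by_cases hb1 : b 0 = 1
  · have hcard : 1 < #Iᶜ := by
      have h1 := (mem_filter.1 hI).2.2 hb1
      have h2 : 0 < #Iᶜ := card_pos.2 ⟨j, mem_compl.2 hj⟩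
      have h3 := card_add_card_compl I
      rw [Fintype.card_fin] at h3
      omega
    obtain ⟨k, hk, hkne⟩ := exists_mem_ne hcard (τ ⟨0, hn⟩)
    refine ⟨k, mem_compl.1 hk, ?_⟩
    have hk0 : (τ.symm k : ℕ) ≠ 0 := by
      intro h
      apply hkne
      rw [← Equiv.symm_apply_eq]
      exact Fin.ext h
    have := Spart_lt_Spart hb (show 1 < (τ.symm k : ℕ) + 1 by omega) (τ.symm k).2
    omega
  · have := Spart_mono b (show 1 ≤ (τ.symm j : ℕ) + 1 by omega)
    exact ⟨j, hj, by omega⟩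

theorem exists_smul_of_const_on_dotFace (hn : 1 ≤ n) (hb : ∀ j < n, 1 ≤ b j)
    (hnd : ¬(n = 1 ∧ b 0 = 1)) {c : Fin n → ℝ} (hc : c ∈ facetNormals n b) (d : Fin n → ℝ)
    (hd : ∀ x ∈ dotFace (bpfPolytope n b) c, ∀ y ∈ dotFace (bpfPolytope n b) c,
      d ⬝ᵥ x = d ⬝ᵥ y) : ∃ t : ℝ, d = t • c := by
  rcases hc with ⟨i, rfl⟩ | ⟨I, hI, rfl⟩
  · refine ⟨-d i, ?_⟩
    ext j
    rcases eq_or_ne j i with rfl | hj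
    · simp
    · have := apply_eq_zero_of_dotProduct_eq hn hb hnd (hd _
        (mem_dotFace_neg_single (one_add_single_mem_bpfPolytope hn hb j) (by simp [hj.symm])) _
        (mem_dotFace_neg_single (one_mem_bpfPolytope hb) rfl))
      simp [hj, this]
  · have hI' := mem_coe.1 hI
    obtain ⟨i, hi⟩ := (mem_filter.1 hI').2.1
    refine ⟨d i, ?_⟩
    ext j
    by_cases hj : j ∈ I
    · simpa [indicatorVec, hj] using apply_eq_of_const_on_dotFace hb (indicatorVec_nonneg I) hd
        (show indicatorVec I j = indicatorVec I i by simp [indicatorVec, hi, hj])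
    set τ := Tuple.sort (indicatorVec I)
    have hτ : Monotone (indicatorVec I ∘ τ) := Tuple.monotone_sort _
    obtain ⟨k, hk, hk2⟩ := exists_notMem_two_le_Spart hb hI' (fun h => hj (h ▸ mem_univ j)) τ
    have hjk := apply_eq_of_const_on_dotFace hb (indicatorVec_nonneg I) hd
      (show indicatorVec I j = indicatorVec I k by simp [indicatorVec, hk, hj])
    have hupd : Function.update (permVertex b τ) k 1 =
        permVertex b τ + Pi.single k (1 - permVertex b τ k) := by
      ext l
      rcases eq_or_ne l k with rfl | hl <;> simp [*]
    have h := hd _ (mem_dotFace_of_dotProduct_eq (indicatorVec_nonneg I) hτ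
        (update_one_mem_bpfPolytope (permVertex_mem hb τ) k) (by
          rw [hupd, dotProduct_add, dotProduct_single]
          simp [indicatorVec, hk])) _ (permVertex_mem_dotFace hb (indicatorVec_nonneg I) hτ)
    have hk2' : (2 : ℝ) ≤ permVertex b τ k := Nat.ofNat_le_cast.2 hk2
    rw [hupd, dotProduct_add, dotProduct_single, add_eq_left, mul_eq_zero] at h
    have hdk : d k = 0 := h.resolve_right (by linarith)
    simp [indicatorVec, hj, hjk, hdk]

theorem finrank_vectorSpan_dotFace (hn : 1 ≤ n) (hb : ∀ j < n, 1 ≤ b j)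
    (hnd : ¬(n = 1 ∧ b 0 = 1)) {c : Fin n → ℝ} (hc : c ∈ facetNormals n b) :
    Module.finrank ℝ (vectorSpan ℝ (dotFace (bpfPolytope n b) c)) = n - 1 := by
  rw [← finrank_ker_dotProduct (ne_zero_of_mem_facetNormals hc), le_antisymm
    (vectorSpan_le_ker_dotProduct fun x hx y hy => dotProduct_eq_of_mem_dotFace hx hy)
    (ker_dotProduct_le_vectorSpan (exists_smul_of_const_on_dotFace hn hb hnd hc))]

theorem finrank_vectorSpan_bpfPolytope (hn : 1 ≤ n) (hb : ∀ j < n, 1 ≤ b j)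
    (hnd : ¬(n = 1 ∧ b 0 = 1)) : Module.finrank ℝ (vectorSpan ℝ (bpfPolytope n b)) = n := by
  have h := ker_dotProduct_le_vectorSpan (F := bpfPolytope n b) (c := 0) fun d hd =>
    ⟨0, by rw [zero_smul, eq_zero_of_dotProduct_const hn hb hnd d hd]⟩
  rw [map_zero, LinearMap.ker_zero, top_le_iff] at h
  rw [h, finrank_top, Module.finrank_fin_fun]

theorem setOf_facets_eq_image (hn : 1 ≤ n) (hb : ∀ j < n, 1 ≤ b j)
    (hnd : ¬(n = 1 ∧ b 0 = 1)) :
    {F : Set (Fin n → ℝ) | F.Nonempty ∧ IsExposed ℝ (bpfPolytope n b) F ∧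
        Module.finrank ℝ (vectorSpan ℝ F) = n - 1} =
      dotFace (bpfPolytope n b) '' facetNormals n b := by
  apply Set.Subset.antisymm
  · rintro F ⟨hne, hexp, hdim⟩
    obtain ⟨c, rfl⟩ := hexp.exists_eq_dotFace hne
    have hc0 : c ≠ 0 := by
      rintro rfl
      have h0 : dotFace (bpfPolytope n b) 0 = bpfPolytope n b := by simp [dotFace]
      rw [h0, finrank_vectorSpan_bpfPolytope hn hb hnd] at hdim
      omega
    obtain ⟨c', hc', hsub⟩ := exists_facetNormal_dotFace_subset hn hb hc0
    obtain ⟨t, ht, rfl⟩ := exists_pos_smul_of_dotFace_subset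
      (eq_zero_of_dotProduct_const hn hb hnd) hc0 (ne_zero_of_mem_facetNormals hc') hne hdim hsub
    exact ⟨_, hc', dotFace_smul _ _ ht⟩
  · rintro _ ⟨c, hc, rfl⟩
    exact ⟨dotFace_nonempty_of_mem_facetNormals hb hc, isExposed_dotFace _ _,
      finrank_vectorSpan_dotFace hn hb hnd hc⟩

theorem injOn_dotFace_facetNormals (hn : 1 ≤ n) (hb : ∀ j < n, 1 ≤ b j)
    (hnd : ¬(n = 1 ∧ b 0 = 1)) :
    Set.InjOn (dotFace (bpfPolytope n b)) (facetNormals n b) := by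
  intro c hc c' hc' h
  obtain ⟨t, ht, h'⟩ := exists_pos_smul_of_dotFace_subset
    (eq_zero_of_dotProduct_const hn hb hnd) (ne_zero_of_mem_facetNormals hc)
    (ne_zero_of_mem_facetNormals hc') (dotFace_nonempty_of_mem_facetNormals hb hc)
    (finrank_vectorSpan_dotFace hn hb hnd hc) h.subset
  exact (eq_of_mem_facetNormals hc hc' ht h').symm

end FacetNormals

/-- The number of facets ((n-1)-dimensional faces) of `X_n(b)` is
`n + 2^n - 1` when `b_1 ≥ 2`, and `n + 2^n - 1 - n` when `b_1 = 1`. -/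
theorem facet_count (n : ℕ) (hn : 1 ≤ n) (b : ℕ → ℕ) (hb : ∀ j < n, 1 ≤ b j)
    (hnd : ¬(n = 1 ∧ b 0 = 1)) :
    {F : Set (Fin n → ℝ) | F.Nonempty ∧ IsExposed ℝ (bpfPolytope n b) F ∧
        Module.finrank ℝ (vectorSpan ℝ F) = n - 1}.ncard
      = if 2 ≤ b 0 then n + 2 ^ n - 1 else n + 2 ^ n - 1 - n := by
  rw [setOf_facets_eq_image hn hb hnd,
    (injOn_dotFace_facetNormals hn hb hnd).ncard_image, ncard_facetNormals hn hb hnd]
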